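/- SDP formulation of linear-quadratic Gaussian optimal transport: consider the linear system x_{k+1} = A x_k + B u_k on ℝ^n with A invertible, (A,B) controllable, horizon T − 1 ≥ n, and Lagrangian L(x,u) = x^T Q x + u^T R u with Q symmetric positive semidefinite and R symmetric positive definite; let c_1^T(x,y) be the associated optimal steering cost from x to y in T−1 steps. Let μ_1 and μ_T be the zero-mean multivariate Gaussian measures on ℝ^n with positive definite covariances Σ_1 and Σ_T respectively. Then inf { ∫_{ℝ^n×ℝ^n} c_1^T(x,y) dπ(x,y) : π a probability measure on ℝ^n×ℝ^n with marginals μ_1 and μ_T } = sup { Tr(P_1 Σ_1) − Tr(P_T Σ_T) : P_1, …, P_T ∈ ℝ^{n×n} symmetric such that for every k = 1,…,T−1, R + B^T P_{k+1} B is positive definite and the block matrix fromBlocks (R + B^T P_{k+1} B) (B^T P_{k+1} A); (A^T P_{k+1} B) (A^T P_{k+1} A − P_k + Q) is positive semidefinite }. -/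

import Mathlib

open MeasureTheory Matrix Finset
open scoped ENNReal

noncomputable section

/-- Trajectory of the linear system `x_{k+1} = A x_k + B u_k` started at `x`. -/
def ltraj {n m : ℕ} (A : Matrix (Fin n) (Fin n) ℝ) (B : Matrix (Fin n) (Fin m) ℝ)
    (x : Fin n → ℝ) (u : ℕ → Fin m → ℝ) : ℕ → Fin n → ℝ
  | 0 => x
  | k + 1 => A.mulVec (ltraj A B x u k) + B.mulVec (u k)

/-- The optimal steering cost `c_1^T(x, y)` of the linear system `x_{k+1} = A x_k + B u_k`
with quadratic Lagrangian `L(x,u) = xᵀ Q x + uᵀ R u`, from `x_1 = x` to `x_T = y`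
(`0`-based: from time `0` to time `T - 1`). -/
def lqCost {n m : ℕ} (A : Matrix (Fin n) (Fin n) ℝ) (B : Matrix (Fin n) (Fin m) ℝ)
    (Q : Matrix (Fin n) (Fin n) ℝ) (R : Matrix (Fin m) (Fin m) ℝ) (T : ℕ)
    (x y : Fin n → ℝ) : ℝ :=
  sInf {r : ℝ | ∃ u : ℕ → Fin m → ℝ, ltraj A B x u (T - 1) = y ∧
    r = ∑ k ∈ Finset.range (T - 1),
      (ltraj A B x u k ⬝ᵥ Q.mulVec (ltraj A B x u k) + u k ⬝ᵥ R.mulVec (u k))}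

/-- The centered Gaussian measure on `Fin n → ℝ` with covariance `S`, given by its density. -/
def centeredGaussian {n : ℕ} (S : Matrix (Fin n) (Fin n) ℝ) : Measure (Fin n → ℝ) :=
  volume.withDensity fun x =>
    ENNReal.ofReal ((Real.sqrt ((2 * Real.pi) ^ n * S.det))⁻¹ *
      Real.exp (-(x ⬝ᵥ S⁻¹.mulVec x) / 2))

lemma centeredGaussian_one (n : ℕ) :
    centeredGaussian (1 : Matrix (Fin n) (Fin n) ℝ) =
      Measure.pi fun _ => ProbabilityTheory.gaussianReal 0 1 := by
  symm
  refine Measure.pi_eq fun s hs => ?_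
  have hdens : ∀ x : Fin n → ℝ,
      (Real.sqrt ((2 * Real.pi) ^ n * (1 : Matrix (Fin n) (Fin n) ℝ).det))⁻¹ *
        Real.exp (-(x ⬝ᵥ (1 : Matrix (Fin n) (Fin n) ℝ)⁻¹.mulVec x) / 2) =
      ∏ i, ProbabilityTheory.gaussianPDFReal 0 1 (x i) := by
    intro x
    simp only [ProbabilityTheory.gaussianPDFReal, Finset.prod_mul_distrib, ← Real.exp_sum]
    congr 1
    · have : √((2 * Real.pi) ^ n) = √(2 * Real.pi) ^ n := by
        rw [Real.sqrt_eq_iff_mul_self_eq (by positivity) (by positivity), ← mul_pow,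
          Real.mul_self_sqrt (by positivity)]
      simp only [det_one, mul_one, this, NNReal.coe_one, Finset.prod_const, Finset.card_univ,
        Fintype.card_fin, inv_pow]
    · simp [dotProduct, ← Finset.sum_div, pow_two]
  simp only [centeredGaussian, hdens]
  rw [withDensity_apply _ (MeasurableSet.univ_pi hs), volume_pi, Measure.restrict_pi_pi,
    ← ofReal_integral_eq_lintegral_ofReal,
    integral_fintype_prod_eq_prod (fun _ : Fin n => ProbabilityTheory.gaussianPDFReal 0 1),
    ENNReal.ofReal_prod_of_nonneg]
  · simp [ProbabilityTheory.gaussianReal_apply_eq_integral]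
  · intro i _
    exact integral_nonneg fun x => ProbabilityTheory.gaussianPDFReal_nonneg _ _ _
  · exact Integrable.fintype_prod fun i =>
      (ProbabilityTheory.integrable_gaussianPDFReal 0 1).restrict
  · exact ae_of_all _ fun x => Finset.prod_nonneg fun i _ =>
      ProbabilityTheory.gaussianPDFReal_nonneg _ _ _

lemma measurable_mulVec {m n : ℕ} (L : Matrix (Fin m) (Fin n) ℝ) :
    Measurable (L.mulVec : (Fin n → ℝ) → Fin m → ℝ) :=
  (Continuous.matrix_mulVec continuous_const continuous_id).measurable

lemma map_mulVec_centeredGaussian {n : ℕ} {S L : Matrix (Fin n) (Fin n) ℝ} (hL : L.det ≠ 0) :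
    (centeredGaussian S).map L.mulVec = centeredGaussian (L * S * Lᵀ) := by
  have hmeas := measurable_mulVec L
  have hLL : L⁻¹ * L = 1 := nonsing_inv_mul _ (isUnit_iff_ne_zero.mpr hL)
  have hdet : (L * S * Lᵀ).det = L.det ^ 2 * S.det := by
    simp only [det_mul, det_transpose]; ring
  refine Measure.ext_of_lintegral _ fun f hf => ?_
  have hg : ∀ M : Matrix (Fin n) (Fin n) ℝ, Measurable fun x : Fin n → ℝ =>
      ENNReal.ofReal ((Real.sqrt ((2 * Real.pi) ^ n * M.det))⁻¹ *
      Real.exp (-(x ⬝ᵥ M⁻¹.mulVec x) / 2)) := by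
    intro M
    refine ENNReal.measurable_ofReal.comp (Continuous.measurable ?_)
    fun_prop
  have hvol := Real.map_matrix_volume_pi_eq_smul_volume_pi hL
  have hvol' : (volume : Measure (Fin n → ℝ)) =
      ENNReal.ofReal |L.det| • (volume : Measure (Fin n → ℝ)).map L.mulVec := by
    have : (volume : Measure (Fin n → ℝ)).map L.mulVec =
      ENNReal.ofReal (abs (det L)⁻¹) • volume := hvol
    rw [this, smul_smul, ← ENNReal.ofReal_mul (abs_nonneg _), ← abs_mul, mul_inv_cancel₀ hL]
    simp
  rw [lintegral_map hf hmeas, centeredGaussian, centeredGaussian,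
    lintegral_withDensity_eq_lintegral_mul (g := fun x => f (L *ᵥ x)) _ (hg S) (hf.comp hmeas),
    lintegral_withDensity_eq_lintegral_mul _ (hg _) hf]
  conv_rhs => rw [hvol']
  rw [lintegral_smul_measure, lintegral_map ((hg _).mul hf) hmeas, smul_eq_mul,
    ← lintegral_const_mul]
  swap
  · exact ((hg _).mul hf).comp hmeas
  refine lintegral_congr fun x => ?_
  simp only [Pi.mul_apply, ← mul_assoc]
  congr 1
  rw [← ENNReal.ofReal_mul (abs_nonneg _), ← mul_assoc]
  congr 2
  · rw [hdet, mul_left_comm, Real.sqrt_mul (sq_nonneg _), Real.sqrt_sq_eq_abs, mul_inv,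
      mul_inv_cancel_left₀ (abs_ne_zero.mpr hL)]
  · congr 3
    rw [Matrix.mul_inv_rev, Matrix.mul_inv_rev, mulVec_mulVec, mul_assoc, mul_assoc, hLL, mul_one,
      ← transpose_nonsing_inv, ← mulVec_mulVec, dotProduct_mulVec (L *ᵥ x), vecMul_transpose,
      mulVec_mulVec, hLL, one_mulVec]

open scoped MatrixOrder in
lemma exists_posSemidef_mul_self_eq {n : ℕ} {S : Matrix (Fin n) (Fin n) ℝ} (hS : S.PosSemidef) :
    ∃ C : Matrix (Fin n) (Fin n) ℝ, C.PosSemidef ∧ C * C = S :=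
  ⟨CFC.sqrt S, Matrix.nonneg_iff_posSemidef.mp (CFC.sqrt_nonneg S),
    CFC.sqrt_mul_sqrt_self S (Matrix.nonneg_iff_posSemidef.mpr hS)⟩

lemma exists_mul_transpose_eq_of_posDef {n : ℕ} {S : Matrix (Fin n) (Fin n) ℝ} (hS : S.PosDef) :
    ∃ C : Matrix (Fin n) (Fin n) ℝ, C.det ≠ 0 ∧ C * Cᵀ = S := by
  obtain ⟨C, hC, rfl⟩ := exists_posSemidef_mul_self_eq hS.posSemidef
  refine ⟨C, fun h => hS.det_pos.ne' (by rw [det_mul, h, mul_zero]), ?_⟩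
  rw [← conjTranspose_eq_transpose_of_trivial, hC.isHermitian.eq]

lemma memLp_eval_pi_gaussianReal {n : ℕ} (i : Fin n) :
    MemLp (fun x : Fin n → ℝ => x i) 2
      (Measure.pi fun _ => ProbabilityTheory.gaussianReal 0 1) :=
  (ProbabilityTheory.memLp_id_gaussianReal' 2 (by simp)).comp_measurePreserving
    (measurePreserving_eval (fun _ : Fin n => ProbabilityTheory.gaussianReal 0 1) i)

lemma integral_eval_mul_eval_pi_gaussianReal {n : ℕ} (i j : Fin n) :
    ∫ x : Fin n → ℝ, x i * x j ∂(Measure.pi fun _ => ProbabilityTheory.gaussianReal 0 1) =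
      (1 : Matrix (Fin n) (Fin n) ℝ) i j := by
  have hprod : ∀ x : Fin n → ℝ, x i * x j =
      ∏ k, (if k = i then x k else 1) * (if k = j then x k else 1) := by
    intro x
    rw [Finset.prod_mul_distrib]
    simp
  have hsq : ∫ x, x * x ∂(ProbabilityTheory.gaussianReal 0 1) = 1 := by
    have h := ProbabilityTheory.variance_fun_id_gaussianReal (μ := 0) (v := 1)
    rw [ProbabilityTheory.variance_eq_integral measurable_id'.aemeasurable] at h
    simpa [pow_two] using h
  simp only [hprod]
  rw [integral_fintype_prod_eq_prod (μ := fun _ : Fin n => ProbabilityTheory.gaussianReal 0 1)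
    (fun k y => (if k = i then y else 1) * (if k = j then y else 1))]
  rcases eq_or_ne i j with rfl | hij
  · rw [one_apply_eq]
    refine Finset.prod_eq_one fun k _ => ?_
    by_cases hk : k = i <;> simp [hk, hsq]
  · rw [one_apply_ne hij]
    refine Finset.prod_eq_zero (Finset.mem_univ i) ?_
    simp [hij]

section Moments

variable {n : ℕ} {S : Matrix (Fin n) (Fin n) ℝ}

lemma exists_centeredGaussian_eq_map (hS : S.PosDef) :
    ∃ C : Matrix (Fin n) (Fin n) ℝ, C * Cᵀ = S ∧ centeredGaussian S =
      (Measure.pi fun _ => ProbabilityTheory.gaussianReal 0 1).map C.mulVec := by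
  obtain ⟨C, hC, rfl⟩ := exists_mul_transpose_eq_of_posDef hS
  refine ⟨C, rfl, ?_⟩
  rw [← centeredGaussian_one, map_mulVec_centeredGaussian hC, mul_one]

lemma isProbabilityMeasure_centeredGaussian (hS : S.PosDef) :
    IsProbabilityMeasure (centeredGaussian S) := by
  obtain ⟨C, -, h⟩ := exists_centeredGaussian_eq_map hS
  rw [h]
  exact Measure.isProbabilityMeasure_map
    (measurable_mulVec C).aemeasurable

lemma memLp_coord_centeredGaussian (hS : S.PosDef) (i : Fin n) :
    MemLp (fun x : Fin n → ℝ => x i) 2 (centeredGaussian S) := by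
  obtain ⟨C, -, h⟩ := exists_centeredGaussian_eq_map hS
  rw [h, memLp_map_measure_iff (measurable_pi_apply i).aestronglyMeasurable
    (measurable_mulVec C).aemeasurable]
  simp only [Function.comp_def, mulVec, dotProduct]
  exact memLp_finsetSum _ fun k _ => (memLp_eval_pi_gaussianReal k).const_mul _

lemma integral_coord_mul_coord_centeredGaussian (hS : S.PosDef) (i j : Fin n) :
    ∫ x, x i * x j ∂(centeredGaussian S) = S i j := by
  obtain ⟨C, hC, h⟩ := exists_centeredGaussian_eq_map hS
  have hint : ∀ a b : Fin n, Integrable (fun x : Fin n → ℝ => C i a * x a * (C j b * x b))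
      (Measure.pi fun _ => ProbabilityTheory.gaussianReal 0 1) := fun a b =>
    ((memLp_eval_pi_gaussianReal a).const_mul _).integrable_mul
      ((memLp_eval_pi_gaussianReal b).const_mul _)
  rw [h, integral_map (measurable_mulVec C).aemeasurable
    (by fun_prop)]
  simp only [mulVec, dotProduct, Finset.sum_mul_sum]
  rw [integral_finsetSum _ fun a _ => integrable_finsetSum _ fun b _ => hint a b]
  simp only [integral_finsetSum _ fun b _ => hint _ b]
  simp only [mul_mul_mul_comm (C i _), integral_const_mul,
    integral_eval_mul_eval_pi_gaussianReal]
  simp [← hC, mul_apply, one_apply]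

lemma integrable_dotProduct_mulVec_of_memLp {n : ℕ} {Ω : Type*} [MeasurableSpace Ω] {μ : Measure Ω}
    {f g : Ω → Fin n → ℝ} (hf : ∀ i, MemLp (fun ω => f ω i) 2 μ)
    (hg : ∀ i, MemLp (fun ω => g ω i) 2 μ) (M : Matrix (Fin n) (Fin n) ℝ) :
    Integrable (fun ω => f ω ⬝ᵥ M *ᵥ g ω) μ := by
  simp only [mulVec, dotProduct]
  refine integrable_finsetSum _ fun i _ => (hf i).integrable_mul (q := 2) ?_
  exact memLp_finsetSum _ fun k _ => (hg k).const_mul _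

lemma integral_dotProduct_mulVec_centeredGaussian (hS : S.PosDef)
    (M : Matrix (Fin n) (Fin n) ℝ) :
    ∫ x, x ⬝ᵥ M *ᵥ x ∂(centeredGaussian S) = (M * S).trace := by
  have hint : ∀ i j : Fin n, Integrable (fun x : Fin n → ℝ => x i * (M i j * x j))
      (centeredGaussian S) := fun i j =>
    (memLp_coord_centeredGaussian hS i).integrable_mul
      ((memLp_coord_centeredGaussian hS j).const_mul _)
  simp only [mulVec, dotProduct, Finset.mul_sum]
  rw [integral_finsetSum _ fun a _ => integrable_finsetSum _ fun b _ => hint a b]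
  simp only [integral_finsetSum _ fun b _ => hint _ b]
  simp only [mul_left_comm _ (M _ _), integral_const_mul,
    integral_coord_mul_coord_centeredGaussian hS, trace, Matrix.diag, mul_apply]
  have hsymm : ∀ i j, S i j = S j i := fun i j => by
    simpa using (congrFun₂ hS.isHermitian.eq j i)
  exact Finset.sum_congr rfl fun i _ => Finset.sum_congr rfl fun j _ => by rw [hsymm]

end Moments
lemma exists_orthogonal_mul_posSemidef_of_det_ne_zero {n : ℕ} {X : Matrix (Fin n) (Fin n) ℝ}
    (hX : X.det ≠ 0) : ∃ O : Matrix (Fin n) (Fin n) ℝ, O * Oᵀ = 1 ∧ (O * X).PosSemidef := by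
  obtain ⟨P, hP, hPX⟩ := exists_posSemidef_mul_self_eq (posSemidef_conjTranspose_mul_self X)
  have hu := isUnit_iff_ne_zero.mpr hX
  have hut : IsUnit Xᵀ.det := by rwa [det_transpose]
  have hPt : Pᵀ = P := by rw [← conjTranspose_eq_transpose_of_trivial, hP.isHermitian.eq]
  rw [conjTranspose_eq_transpose_of_trivial] at hPX
  have hO : (P * X⁻¹)ᵀ * (P * X⁻¹) = 1 := by
    rw [transpose_mul, hPt, mul_assoc, ← mul_assoc P, hPX, mul_assoc, mul_nonsing_inv _ hu,
      mul_one, transpose_nonsing_inv, nonsing_inv_mul _ hut]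
  refine ⟨P * X⁻¹, mul_eq_one_comm.mp hO, ?_⟩
  rwa [mul_assoc, nonsing_inv_mul _ hu, mul_one]

lemma isClosed_setOf_posSemidef (n : ℕ) :
    IsClosed {M : Matrix (Fin n) (Fin n) ℝ | M.PosSemidef} := by
  have : {M : Matrix (Fin n) (Fin n) ℝ | M.PosSemidef} =
      {M | Mᴴ = M} ∩ ⋂ x : Fin n → ℝ, {M | 0 ≤ x ⬝ᵥ M *ᵥ x} := by
    ext M
    simp [posSemidef_iff_dotProduct_mulVec, IsHermitian]
  rw [this]
  refine (isClosed_eq (by fun_prop) continuous_id).inter (isClosed_iInter fun x => ?_)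
  exact isClosed_le continuous_const (by fun_prop)

lemma isCompact_setOf_mul_transpose_eq_one (n : ℕ) :
    IsCompact {O : Matrix (Fin n) (Fin n) ℝ | O * Oᵀ = 1} := by
  refine IsCompact.of_isClosed_subset (isCompact_univ_pi fun _ : Fin n =>
    isCompact_univ_pi fun _ : Fin n => isCompact_Icc (a := (-1 : ℝ)) (b := 1))
    (isClosed_eq (by fun_prop) continuous_const) fun O hO i _ j _ => ?_
  have h := congrFun₂ (show O * Oᵀ = 1 from hO) i i
  simp only [mul_apply, transpose_apply, one_apply_eq] at h
  have h2 : O i j * O i j ≤ 1 := h ▸ Finset.single_le_sum (f := fun j => O i j * O i j)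
    (fun k _ => mul_self_nonneg _) (Finset.mem_univ j)
  exact abs_le.mp (abs_le_one_iff_mul_self_le_one.mpr h2)

lemma exists_orthogonal_mul_posSemidef {n : ℕ} (X : Matrix (Fin n) (Fin n) ℝ) :
    ∃ O : Matrix (Fin n) (Fin n) ℝ, O * Oᵀ = 1 ∧ (O * X).PosSemidef := by
  have hpoly : ∀ t : ℝ, (X + t • (1 : Matrix (Fin n) (Fin n) ℝ)).det = (-X).charpoly.eval t := by
    intro t
    rw [eval_charpoly]
    congr 1
    rw [sub_neg_eq_add, add_comm, smul_one_eq_diagonal]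
    rfl
  have hfreq : ∃ᶠ t in nhds (0 : ℝ), (X + t • (1 : Matrix (Fin n) (Fin n) ℝ)).det ≠ 0 := by
    intro h
    refine (charpoly_monic (-X)).ne_zero (Polynomial.eq_zero_of_infinite_isRoot _ ?_)
    refine (infinite_of_mem_nhds (0 : ℝ) h).mono fun t ht => ?_
    rw [Set.mem_ofPred_eq, Polynomial.IsRoot.def, ← hpoly]
    exact not_not.mp ht
  obtain ⟨t, ht, hdet⟩ := Filter.exists_seq_forall_of_frequently hfreq
  choose O hO hOX using fun k => exists_orthogonal_mul_posSemidef_of_det_ne_zero (hdet k)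
  have : FirstCountableTopology (Matrix (Fin n) (Fin n) ℝ) :=
    inferInstanceAs (FirstCountableTopology (Fin n → Fin n → ℝ))
  obtain ⟨L, hL, φ, hφ, hlim⟩ := (isCompact_setOf_mul_transpose_eq_one n).tendsto_subseq hO
  have hX : Filter.Tendsto (fun k => X + t (φ k) • (1 : Matrix (Fin n) (Fin n) ℝ)) Filter.atTop
      (nhds (X + (0 : ℝ) • 1)) :=
    tendsto_const_nhds.add ((ht.comp hφ.tendsto_atTop).smul_const _)
  have hlim' := hlim.mul hX
  rw [zero_smul, add_zero] at hlim'
  have hmem : L * X ∈ {M : Matrix (Fin n) (Fin n) ℝ | M.PosSemidef} :=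
    (isClosed_setOf_posSemidef n).mem_of_tendsto hlim' (Filter.Eventually.of_forall fun k => hOX _)
  exact ⟨L, hL, hmem⟩

lemma exists_isLeast_fiber {E F : Type*} [AddCommGroup E] [Module ℝ E] [FiniteDimensional ℝ E]
    [AddCommGroup F] [Module ℝ F] (b : LinearMap.BilinForm ℝ E) (hsymm : ∀ v w, b v w = b w v)
    (hpos : ∀ v, 0 ≤ b v v) (f : E →ₗ[ℝ] F) (hf : Function.Surjective f)
    (hker : ∀ v, f v = 0 → b v v = 0 → v = 0) :
    ∃ s : F →ₗ[ℝ] E, ∀ w, IsLeast {r | ∃ v, f v = w ∧ r = b v v} (b (s w) (s w)) := by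
  have hcompl : IsCompl (LinearMap.ker f) (b.orthogonal (LinearMap.ker f)) := by
    rw [LinearMap.BilinForm.isCompl_orthogonal_iff_disjoint fun v w h => by rw [hsymm, h],
      Submodule.disjoint_def]
    exact fun v hv hv' => hker v hv (hv' v hv)
  obtain ⟨g, hg⟩ := f.exists_rightInverse_of_surjective (LinearMap.range_eq_top.mpr hf)
  have hg' : ∀ w, f (g w) = w := fun w => LinearMap.congr_fun hg w
  let p := (b.orthogonal (LinearMap.ker f)).projection (LinearMap.ker f) hcompl.symm
  have hp : ∀ v, p v ∈ b.orthogonal (LinearMap.ker f) :=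
    fun v => Submodule.projection_apply_mem hcompl.symm v
  have hfp : ∀ v, f (p v) = f v := fun v => by
    have := LinearMap.mem_ker.mp (Submodule.sub_projection_mem hcompl.symm v)
    rw [map_sub, sub_eq_zero] at this
    exact this.symm
  refine ⟨p ∘ₗ g, fun w => ⟨⟨_, by simp [hfp, hg'], rfl⟩, ?_⟩⟩
  rintro _ ⟨v, hv, rfl⟩
  set o := (p ∘ₗ g) w with ho
  have hko : f (v - o) = 0 := by simp [ho, hfp, hg', hv]
  have horth : b (v - o) o = 0 := hp _ _ hko
  have h1 : b v v = b (v - o) (v - o) + 2 * b (v - o) o + b o o := by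
    have := hsymm v o
    simp only [map_sub, LinearMap.sub_apply]
    linarith
  have := hpos (v - o)
  linarith
/-- The total running cost of the control `u` from the initial state `x` over `N` steps. -/
def runningCost {n m : ℕ} (A : Matrix (Fin n) (Fin n) ℝ) (B : Matrix (Fin n) (Fin m) ℝ)
    (Q : Matrix (Fin n) (Fin n) ℝ) (R : Matrix (Fin m) (Fin m) ℝ) (N : ℕ)
    (x : Fin n → ℝ) (u : ℕ → Fin m → ℝ) : ℝ :=
  ∑ k ∈ Finset.range N,
    (ltraj A B x u k ⬝ᵥ Q.mulVec (ltraj A B x u k) + u k ⬝ᵥ R.mulVec (u k))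

section Control

variable {n m : ℕ} {A : Matrix (Fin n) (Fin n) ℝ} {B : Matrix (Fin n) (Fin m) ℝ}
  {Q : Matrix (Fin n) (Fin n) ℝ} {R : Matrix (Fin m) (Fin m) ℝ}

lemma ltraj_congr {x : Fin n → ℝ} {u v : ℕ → Fin m → ℝ} {N : ℕ} (h : ∀ k < N, u k = v k) :
    ltraj A B x u N = ltraj A B x v N := by
  induction N with
  | zero => rfl
  | succ N ih => rw [ltraj, ltraj, ih fun k hk => h k (hk.trans N.lt_succ_self), h N N.lt_succ_self]

lemma runningCost_congr {x : Fin n → ℝ} {u v : ℕ → Fin m → ℝ} {N : ℕ} (h : ∀ k < N, u k = v k) :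
    runningCost A B Q R N x u = runningCost A B Q R N x v := by
  refine Finset.sum_congr rfl fun k hk => ?_
  have hk := Finset.mem_range.mp hk
  rw [ltraj_congr fun j hj => h j (hj.trans hk), h k hk]

lemma runningCost_succ (N : ℕ) (x : Fin n → ℝ) (u : ℕ → Fin m → ℝ) :
    runningCost A B Q R (N + 1) x u = runningCost A B Q R N x u +
      (ltraj A B x u N ⬝ᵥ Q *ᵥ ltraj A B x u N + u N ⬝ᵥ R *ᵥ u N) :=
  Finset.sum_range_succ _ _

lemma dotProduct_mulVec_nonneg_of_posSemidef {k : ℕ} {M : Matrix (Fin k) (Fin k) ℝ}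
    (hM : M.PosSemidef) (x : Fin k → ℝ) : 0 ≤ x ⬝ᵥ M *ᵥ x := by
  simpa using hM.dotProduct_mulVec_nonneg x

lemma dotProduct_mulVec_pos_of_posDef {k : ℕ} {M : Matrix (Fin k) (Fin k) ℝ}
    (hM : M.PosDef) {x : Fin k → ℝ} (hx : x ≠ 0) : 0 < x ⬝ᵥ M *ᵥ x := by
  simpa using hM.dotProduct_mulVec_pos hx

lemma runningCost_nonneg (hQ : Q.PosSemidef) (hR : R.PosDef) (N : ℕ) (x : Fin n → ℝ)
    (u : ℕ → Fin m → ℝ) : 0 ≤ runningCost A B Q R N x u :=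
  Finset.sum_nonneg fun _ _ => add_nonneg (dotProduct_mulVec_nonneg_of_posSemidef hQ _)
    (dotProduct_mulVec_nonneg_of_posSemidef hR.posSemidef _)

lemma runningCost_pos (hQ : Q.PosSemidef) (hR : R.PosDef) {N : ℕ} {x : Fin n → ℝ}
    {u : ℕ → Fin m → ℝ} {k : ℕ} (hk : k < N) (hu : u k ≠ 0) : 0 < runningCost A B Q R N x u :=
  Finset.sum_pos' (fun _ _ => add_nonneg (dotProduct_mulVec_nonneg_of_posSemidef hQ _)
    (dotProduct_mulVec_nonneg_of_posSemidef hR.posSemidef _))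
    ⟨k, Finset.mem_range.mpr hk, add_pos_of_nonneg_of_pos
      (dotProduct_mulVec_nonneg_of_posSemidef hQ _) (dotProduct_mulVec_pos_of_posDef hR hu)⟩

lemma ltraj_eq_sum (x : Fin n → ℝ) (u : ℕ → Fin m → ℝ) (N : ℕ) :
    ltraj A B x u N =
      (A ^ N) *ᵥ x + ∑ k ∈ Finset.range N, (A ^ (N - 1 - k) * B) *ᵥ u k := by
  induction N with
  | zero => simp [ltraj]
  | succ N ih =>
    rw [ltraj, ih, Finset.sum_range_succ, mulVec_add, mulVec_mulVec, ← pow_succ', add_assoc]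
    congr 1
    simp only [Nat.add_sub_cancel, Nat.sub_self, pow_zero, Matrix.one_mul]
    congr 1
    rw [mulVec_sum]
    refine Finset.sum_congr rfl fun k hk => ?_
    have hk := Finset.mem_range.mp hk
    rw [mulVec_mulVec, ← Matrix.mul_assoc, ← pow_succ']
    congr 3
    omega

lemma exists_ltraj_eq (hctrb : (Matrix.of fun (i : Fin n) (j : Fin n × Fin m) =>
      (A ^ (j.1 : ℕ) * B) i j.2).rank = n) {N : ℕ} (hN : n ≤ N) (x y : Fin n → ℝ) :
    ∃ u : ℕ → Fin m → ℝ, ltraj A B x u N = y := by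
  set C : Matrix (Fin n) (Fin n × Fin m) ℝ := Matrix.of fun i j => (A ^ (j.1 : ℕ) * B) i j.2
  have hsurj : LinearMap.range C.mulVecLin = ⊤ :=
    Submodule.eq_top_of_finrank_eq (by rw [← Matrix.rank, hctrb]; simp)
  obtain ⟨w, hw⟩ := LinearMap.range_eq_top.mp hsurj (y - (A ^ N) *ᵥ x)
  refine ⟨fun k j => if h : N - 1 - k < n then w (⟨N - 1 - k, h⟩, j) else 0, ?_⟩
  rw [ltraj_eq_sum, ← Finset.sum_range_reflect, add_comm, ← eq_sub_iff_add_eq, ← hw]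
  have hsub : ∀ k ∈ Finset.range N, N - 1 - (N - 1 - k) = k := fun k hk => by
    have := Finset.mem_range.mp hk
    omega
  rw [Finset.sum_congr rfl fun k hk => by rw [hsub k hk]]
  rw [← Finset.sum_subset (Finset.range_mono hN), Finset.sum_range]
  · ext i
    simp only [C, mulVecLin_apply, mulVec, dotProduct, Finset.sum_apply, of_apply,
      Fintype.sum_prod_type, Fin.is_lt, dite_true, Fin.eta]
  · intro k _ hk
    have hk : ¬ k < n := by simpa using hk
    ext i
    simp [hk, mulVec, dotProduct]

end Control

section Duality

variable {n m : ℕ} {A : Matrix (Fin n) (Fin n) ℝ} {B : Matrix (Fin n) (Fin m) ℝ}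
  {Q : Matrix (Fin n) (Fin n) ℝ} {R : Matrix (Fin m) (Fin m) ℝ}

/-- The state at time `k` as a linear function of the initial state and the control sequence. -/
def ltrajLin (A : Matrix (Fin n) (Fin n) ℝ) (B : Matrix (Fin n) (Fin m) ℝ) :
    ℕ → ((Fin n → ℝ) × (ℕ → Fin m → ℝ)) →ₗ[ℝ] (Fin n → ℝ)
  | 0 => LinearMap.fst ℝ _ _
  | k + 1 => A.mulVecLin ∘ₗ ltrajLin A B k +
      B.mulVecLin ∘ₗ LinearMap.proj k ∘ₗ LinearMap.snd ℝ _ _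

lemma ltrajLin_apply (k : ℕ) (p : (Fin n → ℝ) × (ℕ → Fin m → ℝ)) :
    ltrajLin A B k p = ltraj A B p.1 p.2 k := by
  induction k with
  | zero => rfl
  | succ k ih => simp [ltrajLin, ltraj, ih]

lemma dotProduct_mulVec_comm_of_isSymm {k : ℕ} {M : Matrix (Fin k) (Fin k) ℝ} (hM : M.IsSymm)
    (x y : Fin k → ℝ) : x ⬝ᵥ M *ᵥ y = y ⬝ᵥ M *ᵥ x := by
  rw [dotProduct_mulVec, ← mulVec_transpose, hM.eq, dotProduct_comm]

lemma isSymm_of_isHermitian {k : ℕ} {M : Matrix (Fin k) (Fin k) ℝ} (hM : M.IsHermitian) :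
    M.IsSymm := by
  rw [IsSymm, ← conjTranspose_eq_transpose_of_trivial, hM.eq]

/-- The polarization of `runningCost`, a bilinear form in initial state and control sequence. -/
def runningCostBilin (A : Matrix (Fin n) (Fin n) ℝ) (B : Matrix (Fin n) (Fin m) ℝ)
    (Q : Matrix (Fin n) (Fin n) ℝ) (R : Matrix (Fin m) (Fin m) ℝ) (N : ℕ) :
    LinearMap.BilinForm ℝ ((Fin n → ℝ) × (ℕ → Fin m → ℝ)) :=
  ∑ k ∈ Finset.range N, ((toLinearMap₂' ℝ Q).compl₁₂ (ltrajLin A B k) (ltrajLin A B k) +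
    (toLinearMap₂' ℝ R).compl₁₂ (LinearMap.proj k ∘ₗ LinearMap.snd ℝ _ _)
      (LinearMap.proj k ∘ₗ LinearMap.snd ℝ _ _))

lemma runningCostBilin_apply (N : ℕ) (p q : (Fin n → ℝ) × (ℕ → Fin m → ℝ)) :
    runningCostBilin A B Q R N p q = ∑ k ∈ Finset.range N,
      (ltraj A B p.1 p.2 k ⬝ᵥ Q *ᵥ ltraj A B q.1 q.2 k + p.2 k ⬝ᵥ R *ᵥ q.2 k) := by
  simp [runningCostBilin, LinearMap.sum_apply, toLinearMap₂'_apply', ltrajLin_apply]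

lemma exists_quadratic_isLeast_runningCost
    (hctrb : (Matrix.of fun (i : Fin n) (j : Fin n × Fin m) =>
      (A ^ (j.1 : ℕ) * B) i j.2).rank = n)
    (hQ : Q.PosSemidef) (hR : R.PosDef) {N : ℕ} (hN : n ≤ N) :
    ∃ M₁ M₂ M₃ : Matrix (Fin n) (Fin n) ℝ, M₁.IsSymm ∧ M₃.IsSymm ∧ ∀ x y,
      IsLeast {r | ∃ u, ltraj A B x u N = y ∧ r = runningCost A B Q R N x u}
        (x ⬝ᵥ M₁ *ᵥ x + 2 * (x ⬝ᵥ M₂ *ᵥ y) + y ⬝ᵥ M₃ *ᵥ y) := by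
  let ext : (Fin N → Fin m → ℝ) →ₗ[ℝ] (ℕ → Fin m → ℝ) :=
    LinearMap.pi fun k => if h : k < N then LinearMap.proj ⟨k, h⟩ else 0
  have hext : ∀ (u : ℕ → Fin m → ℝ), ∀ k < N, u k = ext (fun i => u i) k := by
    intro u k hk
    simp [ext, hk]
  let e : ((Fin n → ℝ) × (Fin N → Fin m → ℝ)) →ₗ[ℝ] (Fin n → ℝ) × (ℕ → Fin m → ℝ) :=
    LinearMap.prodMap LinearMap.id ext
  let b : LinearMap.BilinForm ℝ ((Fin n → ℝ) × (Fin N → Fin m → ℝ)) :=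
    (runningCostBilin A B Q R N).compl₁₂ e e
  let f : ((Fin n → ℝ) × (Fin N → Fin m → ℝ)) →ₗ[ℝ] (Fin n → ℝ) × (Fin n → ℝ) :=
    LinearMap.prod (LinearMap.fst ℝ _ _) (ltrajLin A B N ∘ₗ e)
  have hb : ∀ v, b v v = runningCost A B Q R N v.1 (ext v.2) := fun v =>
    runningCostBilin_apply N (e v) (e v)
  have hf : ∀ v, f v = (v.1, ltraj A B v.1 (ext v.2) N) := fun v =>
    Prod.ext rfl (ltrajLin_apply N (e v))
  have hsymm : ∀ v w, b v w = b w v := by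
    intro v w
    simp only [b, LinearMap.compl₁₂_apply, runningCostBilin_apply]
    refine Finset.sum_congr rfl fun k _ => ?_
    rw [dotProduct_mulVec_comm_of_isSymm (isSymm_of_isHermitian hQ.isHermitian),
      dotProduct_mulVec_comm_of_isSymm (isSymm_of_isHermitian hR.isHermitian)]
  obtain ⟨s, hs⟩ := exists_isLeast_fiber b hsymm
    (fun v => hb v ▸ runningCost_nonneg hQ hR _ _ _) f
    (by
      rintro ⟨x, y⟩
      obtain ⟨u, hu⟩ := exists_ltraj_eq hctrb hN x y
      refine ⟨(x, fun i => u i), ?_⟩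
      rw [hf, ← ltraj_congr (hext u), hu])
    (by
      rintro ⟨x, u⟩ hv hb0
      rw [hf] at hv
      rw [hb] at hb0
      obtain ⟨rfl, -⟩ := Prod.mk.inj hv
      refine Prod.ext rfl ?_
      by_contra hu
      obtain ⟨k, hk⟩ := Function.ne_iff.mp hu
      refine (runningCost_pos (A := A) (B := B) (u := ext u) hQ hR k.2 ?_).ne' hb0
      simpa [ext] using hk)
  let β := b.compl₁₂ s s
  let i₁ := LinearMap.inl ℝ (Fin n → ℝ) (Fin n → ℝ)
  let i₂ := LinearMap.inr ℝ (Fin n → ℝ) (Fin n → ℝ)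
  have hβ : ∀ v w, β v w = β w v := fun v w => hsymm _ _
  have hmat : ∀ (γ : LinearMap.BilinForm ℝ (Fin n → ℝ)) (x y : Fin n → ℝ),
      x ⬝ᵥ (LinearMap.toMatrix₂' ℝ γ) *ᵥ y = γ x y := by
    intro γ x y
    rw [← toLinearMap₂'_apply', toLinearMap₂'_toMatrix']
  refine ⟨LinearMap.toMatrix₂' ℝ (β.compl₁₂ i₁ i₁), LinearMap.toMatrix₂' ℝ (β.compl₁₂ i₁ i₂),
    LinearMap.toMatrix₂' ℝ (β.compl₁₂ i₂ i₂), ?_, ?_, fun x y => ?_⟩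
  · ext i j
    simp only [transpose_apply, LinearMap.toMatrix₂'_apply, LinearMap.compl₁₂_apply]
    exact hβ _ _
  · ext i j
    simp only [transpose_apply, LinearMap.toMatrix₂'_apply, LinearMap.compl₁₂_apply]
    exact hβ _ _
  · have hval : x ⬝ᵥ (LinearMap.toMatrix₂' ℝ (β.compl₁₂ i₁ i₁)) *ᵥ x +
        2 * (x ⬝ᵥ (LinearMap.toMatrix₂' ℝ (β.compl₁₂ i₁ i₂)) *ᵥ y) +
        y ⬝ᵥ (LinearMap.toMatrix₂' ℝ (β.compl₁₂ i₂ i₂)) *ᵥ y = β (x, y) (x, y) := by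
      have hxy : (x, y) = i₁ x + i₂ y := by simp [i₁, i₂]
      simp only [hmat, LinearMap.compl₁₂_apply]
      rw [hxy]
      simp only [map_add, LinearMap.add_apply]
      rw [hβ (i₂ y) (i₁ x)]
      ring
    have hset : {r | ∃ u, ltraj A B x u N = y ∧ r = runningCost A B Q R N x u} =
        {r | ∃ v, f v = (x, y) ∧ r = b v v} := by
      ext r
      constructor
      · rintro ⟨u, hu, rfl⟩
        refine ⟨(x, fun i => u i), ?_, ?_⟩
        · rw [hf, ← ltraj_congr (hext u), hu]
        · rw [hb, ← runningCost_congr (hext u)]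
      · rintro ⟨⟨x', u⟩, hv, rfl⟩
        rw [hf] at hv
        obtain rfl : x' = x := congrArg Prod.fst hv
        exact ⟨ext u, congrArg Prod.snd hv, hb _⟩
    rw [hval, hset]
    exact hs (x, y)

lemma elim_dotProduct_fromBlocks_mulVec_elim (G P : Matrix (Fin n) (Fin n) ℝ) (x : Fin n → ℝ)
    (u : Fin m → ℝ) :
    Sum.elim u x ⬝ᵥ (fromBlocks (R + Bᵀ * G * B) (Bᵀ * G * A) (Aᵀ * G * B)
      (Aᵀ * G * A - P + Q)) *ᵥ Sum.elim u x =
    x ⬝ᵥ Q *ᵥ x + u ⬝ᵥ R *ᵥ u + (A *ᵥ x + B *ᵥ u) ⬝ᵥ G *ᵥ (A *ᵥ x + B *ᵥ u) - x ⬝ᵥ P *ᵥ x := by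
  have hmove : ∀ {k l : ℕ} (M : Matrix (Fin k) (Fin n) ℝ) (K : Matrix (Fin n) (Fin l) ℝ)
      (v : Fin k → ℝ) (w : Fin l → ℝ), v ⬝ᵥ (M * G * K) *ᵥ w = (Mᵀ *ᵥ v) ⬝ᵥ G *ᵥ (K *ᵥ w) := by
    intro k l M K v w
    rw [Matrix.mul_assoc, ← mulVec_mulVec, ← mulVec_mulVec, dotProduct_mulVec, mulVec_transpose]
  rw [fromBlocks_mulVec]
  simp only [Sum.elim_comp_inl, Sum.elim_comp_inr, sumElim_dotProduct_sumElim, add_mulVec,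
    sub_mulVec, dotProduct_add, dotProduct_sub, add_dotProduct, mulVec_add, hmove,
    transpose_transpose]
  ring

lemma quadratic_le_runningCost_add {P : ℕ → Matrix (Fin n) (Fin n) ℝ} {N : ℕ}
    (hP : ∀ k < N, (fromBlocks (R + Bᵀ * P (k + 1) * B) (Bᵀ * P (k + 1) * A)
      (Aᵀ * P (k + 1) * B) (Aᵀ * P (k + 1) * A - P k + Q)).PosSemidef)
    (x : Fin n → ℝ) (u : ℕ → Fin m → ℝ) :
    x ⬝ᵥ P 0 *ᵥ x ≤ runningCost A B Q R N x u + ltraj A B x u N ⬝ᵥ P N *ᵥ ltraj A B x u N := by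
  induction N with
  | zero => simp [runningCost, ltraj]
  | succ N ih =>
    have h := (hP N N.lt_succ_self).dotProduct_mulVec_nonneg (Sum.elim (u N) (ltraj A B x u N))
    rw [star_trivial, elim_dotProduct_fromBlocks_mulVec_elim] at h
    have := ih fun k hk => hP k (hk.trans N.lt_succ_self)
    rw [runningCost_succ, ltraj]
    linarith

lemma exists_riccati_step (hQ : Q.IsSymm) {G : Matrix (Fin n) (Fin n) ℝ}
    (hG : G.IsSymm) (hH : (R + Bᵀ * G * B).PosDef) :
    ∃ P : Matrix (Fin n) (Fin n) ℝ, P.IsSymm ∧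
      (fromBlocks (R + Bᵀ * G * B) (Bᵀ * G * A) (Aᵀ * G * B)
        (Aᵀ * G * A - P + Q)).PosSemidef ∧
      ∀ x, ∃ u, x ⬝ᵥ Q *ᵥ x + u ⬝ᵥ R *ᵥ u + (A *ᵥ x + B *ᵥ u) ⬝ᵥ G *ᵥ (A *ᵥ x + B *ᵥ u) =
        x ⬝ᵥ P *ᵥ x := by
  set H := R + Bᵀ * G * B with hHdef
  set W := Bᵀ * G * A with hW
  have hWt : Aᵀ * G * B = Wᴴ := by
    rw [hW, conjTranspose_eq_transpose_of_trivial, transpose_mul, transpose_mul,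
      transpose_transpose, hG.eq, Matrix.mul_assoc]
  have hHs : Hᵀ = H := isSymm_of_isHermitian hH.isHermitian
  let := hH.isUnit.invertible
  have hD : Aᵀ * G * A - (Q + Aᵀ * G * A - Wᴴ * H⁻¹ * W) + Q = Wᴴ * H⁻¹ * W := by abel
  refine ⟨Q + Aᵀ * G * A - Wᴴ * H⁻¹ * W, ?_, ?_, fun x => ?_⟩
  · rw [IsSymm, transpose_sub, transpose_add, hQ.eq]
    simp only [conjTranspose_eq_transpose_of_trivial, transpose_mul, transpose_transpose, hG.eq,
      transpose_nonsing_inv, hHs, Matrix.mul_assoc]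
  · rw [hWt, hD, hH.fromBlocks₁₁, sub_self]
    exact PosSemidef.zero
  · refine ⟨-((H⁻¹ * W) *ᵥ x), ?_⟩
    have h := elim_dotProduct_fromBlocks_mulVec_elim (A := A) (B := B) (Q := Q) (R := R) G
      (Q + Aᵀ * G * A - Wᴴ * H⁻¹ * W) x (-((H⁻¹ * W) *ᵥ x))
    rw [← hHdef, ← hW, hWt, hD, dotProduct_mulVec] at h
    have h2 := schur_complement_eq₁₁ (A := H) W (Wᴴ * H⁻¹ * W) (-((H⁻¹ * W) *ᵥ x)) x
      hH.isHermitian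
    rw [star_trivial, sub_self, neg_add_cancel, star_zero, zero_vecMul, zero_dotProduct,
      vecMul_zero, zero_dotProduct, add_zero] at h2
    rw [h2] at h
    linarith

lemma exists_riccati_sequence (hQ : Q.IsSymm) (hR : R.IsSymm) (N : ℕ)
    {G : Matrix (Fin n) (Fin n) ℝ} (hG : G.IsSymm)
    (hpos : ∀ u : ℕ → Fin m → ℝ, (∃ k < N, u k ≠ 0) →
      0 < runningCost A B Q R N 0 u + ltraj A B 0 u N ⬝ᵥ G *ᵥ ltraj A B 0 u N) :
    ∃ P : ℕ → Matrix (Fin n) (Fin n) ℝ, P N = G ∧ (∀ k ≤ N, (P k).IsSymm) ∧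
      (∀ k < N, (R + Bᵀ * P (k + 1) * B).PosDef ∧
        (fromBlocks (R + Bᵀ * P (k + 1) * B) (Bᵀ * P (k + 1) * A)
          (Aᵀ * P (k + 1) * B) (Aᵀ * P (k + 1) * A - P k + Q)).PosSemidef) ∧
      ∀ x, ∃ u, runningCost A B Q R N x u + ltraj A B x u N ⬝ᵥ G *ᵥ ltraj A B x u N =
        x ⬝ᵥ P 0 *ᵥ x := by
  induction N generalizing G with
  | zero => exact ⟨fun _ => G, rfl, fun _ _ => hG, by simp, fun x => ⟨0, by simp [runningCost, ltraj]⟩⟩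
  | succ N ih =>
    have hlt : ∀ (x : Fin n → ℝ) (u : ℕ → Fin m → ℝ) (w : Fin m → ℝ),
        ltraj A B x (Function.update u N w) N = ltraj A B x u N := fun x u w =>
      ltraj_congr fun k hk => Function.update_of_ne hk.ne _ _
    have hstep : ∀ (x : Fin n → ℝ) (u : ℕ → Fin m → ℝ) (w : Fin m → ℝ),
        runningCost A B Q R (N + 1) x (Function.update u N w) +
          ltraj A B x (Function.update u N w) (N + 1) ⬝ᵥ
            G *ᵥ ltraj A B x (Function.update u N w) (N + 1) =
        runningCost A B Q R N x u + (ltraj A B x u N ⬝ᵥ Q *ᵥ ltraj A B x u N + w ⬝ᵥ R *ᵥ w +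
          (A *ᵥ ltraj A B x u N + B *ᵥ w) ⬝ᵥ G *ᵥ (A *ᵥ ltraj A B x u N + B *ᵥ w)) := by
      intro x u w
      rw [runningCost_succ, ltraj, hlt, Function.update_self, runningCost_congr (v := u)
        fun k hk => Function.update_of_ne hk.ne _ _]
      ring
    have hzero : ∀ k, ltraj A B 0 0 k = 0 := by
      intro k
      induction k with
      | zero => rfl
      | succ k ih => simp [ltraj, ih]
    have hH : (R + Bᵀ * G * B).PosDef := by
      rw [posDef_iff_dotProduct_mulVec]
      refine ⟨?_, fun w hw => ?_⟩
      · rw [IsHermitian, conjTranspose_eq_transpose_of_trivial]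
        simp only [transpose_add, transpose_mul, transpose_transpose, hR.eq, hG.eq,
          Matrix.mul_assoc]
      · have h := hpos (Function.update 0 N w) ⟨N, N.lt_succ_self, by simpa using hw⟩
        have h2 := elim_dotProduct_fromBlocks_mulVec_elim (A := A) (B := B) (Q := Q) (R := R) G 0 0 w
        rw [hstep, hzero] at h
        rw [fromBlocks_mulVec] at h2
        simp [runningCost, hzero, sumElim_dotProduct_sumElim] at h h2
        simpa [h2] using h
    obtain ⟨G', hG', hblock, hatt⟩ := exists_riccati_step (A := A) hQ hG hH
    obtain ⟨P, hPN, hPs, hPf, hPatt⟩ := ih hG' (by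
      rintro u ⟨k, hk, hu⟩
      obtain ⟨w, hw⟩ := hatt (ltraj A B 0 u N)
      have h := hpos (Function.update u N w)
        ⟨k, hk.trans N.lt_succ_self, by rwa [Function.update_of_ne hk.ne]⟩
      rwa [hstep, hw] at h)
    refine ⟨Function.update P (N + 1) G, by simp, fun k hk => ?_, fun k hk => ?_, fun x => ?_⟩
    · rcases hk.eq_or_lt with rfl | hk
      · simpa using hG
      · rw [Function.update_of_ne hk.ne]
        exact hPs k (Nat.lt_succ_iff.mp hk)
    · rw [Function.update_of_ne hk.ne]
      rcases (Nat.lt_succ_iff.mp hk).eq_or_lt with rfl | hk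
      · rw [Function.update_self, hPN]
        exact ⟨hH, hblock⟩
      · rw [Function.update_of_ne (by omega)]
        exact hPf k hk
    · obtain ⟨u, hu⟩ := hPatt x
      obtain ⟨w, hw⟩ := hatt (ltraj A B x u N)
      refine ⟨Function.update u N w, ?_⟩
      rw [hstep, hw, hu, Function.update_of_ne (by omega)]

end Duality

lemma exists_transport_factorization {n : ℕ} (M S₁ ST : Matrix (Fin n) (Fin n) ℝ)
    (hS₁ : S₁.PosDef) (hST : ST.PosDef) :
    ∃ L D : Matrix (Fin n) (Fin n) ℝ, L.det ≠ 0 ∧ D.PosSemidef ∧ L * S₁ * Lᵀ = ST ∧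
      M = -(Lᵀ * D) := by
  obtain ⟨C₁, hC₁, rfl⟩ := exists_mul_transpose_eq_of_posDef hS₁
  obtain ⟨CT, hCT, rfl⟩ := exists_mul_transpose_eq_of_posDef hST
  obtain ⟨O, hO, hOX⟩ := exists_orthogonal_mul_posSemidef (-(C₁ᵀ * M * CT))
  have hO' : Oᵀ * O = 1 := mul_eq_one_comm.mp hO
  have hu₁ := isUnit_iff_ne_zero.mpr hC₁
  have huT := isUnit_iff_ne_zero.mpr hCT
  have hut₁ : IsUnit C₁ᵀ.det := by rwa [det_transpose]
  have hutT : IsUnit CTᵀ.det := by rwa [det_transpose]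
  refine ⟨CT * O * C₁⁻¹, CTᵀ⁻¹ * (O * -(C₁ᵀ * M * CT)) * CT⁻¹, ?_, ?_, ?_, ?_⟩
  · have : O.det ≠ 0 := fun h => by
      have := congrArg det hO
      simp [h] at this
    rw [det_mul, det_mul]
    exact mul_ne_zero (mul_ne_zero hCT this)
      (isUnit_nonsing_inv_det _ hu₁).ne_zero
  · have := hOX.conjTranspose_mul_mul_same CT⁻¹
    rwa [conjTranspose_eq_transpose_of_trivial, transpose_nonsing_inv] at this
  · calc CT * O * C₁⁻¹ * (C₁ * C₁ᵀ) * (CT * O * C₁⁻¹)ᵀ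
        = CT * O * (C₁⁻¹ * C₁) * (C₁ᵀ * C₁ᵀ⁻¹) * Oᵀ * CTᵀ := by
          simp only [transpose_mul, transpose_nonsing_inv, Matrix.mul_assoc]
      _ = CT * (O * Oᵀ) * CTᵀ := by
          rw [nonsing_inv_mul _ hu₁, mul_nonsing_inv _ hut₁]
          simp only [Matrix.mul_one, Matrix.mul_assoc]
      _ = CT * CTᵀ := by rw [hO, Matrix.mul_one]
  · symm
    calc -((CT * O * C₁⁻¹)ᵀ * (CTᵀ⁻¹ * (O * -(C₁ᵀ * M * CT)) * CT⁻¹))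
        = C₁ᵀ⁻¹ * (Oᵀ * (CTᵀ * CTᵀ⁻¹) * O) * C₁ᵀ * M * (CT * CT⁻¹) := by
          simp only [transpose_mul, transpose_nonsing_inv, Matrix.mul_assoc, Matrix.neg_mul,
            Matrix.mul_neg, neg_neg]
      _ = M := by
          rw [mul_nonsing_inv _ hutT, Matrix.mul_one, hO', Matrix.mul_one,
            nonsing_inv_mul _ hut₁, Matrix.one_mul, mul_nonsing_inv _ huT, Matrix.mul_one]

/-- SDP formulation of linear-quadratic Gaussian optimal transport.
For the controllable linear system `x_{k+1} = A x_k + B u_k` with `A` invertible,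
horizon `T - 1 ≥ n`, Lagrangian `xᵀ Q x + uᵀ R u` (`Q` PSD, `R` PD), and zero-mean
Gaussian marginals with positive definite covariances `S₁`, `Σ_T`, the Kantorovich value
`inf_π ∫ c_1^T dπ` equals the SDP value
`sup { Tr(P₁S₁) - Tr(P_TΣ_T) }` over symmetric `P_1, …, P_T` satisfying, for each `k`,
`R + Bᵀ P_{k+1} B ≻ 0` and
`fromBlocks (R + Bᵀ P_{k+1} B) (Bᵀ P_{k+1} A) (Aᵀ P_{k+1} B) (Aᵀ P_{k+1} A - P_k + Q) ⪰ 0`.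
(Indices are `0`-based: `P 0, …, P (T-1)`.) -/
theorem lq_gaussian_transport_sdp
    (n m T : ℕ) (hT : 2 ≤ T) (hTn : n ≤ T - 1)
    (A : Matrix (Fin n) (Fin n) ℝ) (hA : IsUnit A.det)
    (B : Matrix (Fin n) (Fin m) ℝ)
    (hctrb : (Matrix.of fun (i : Fin n) (j : Fin n × Fin m) =>
      (A ^ (j.1 : ℕ) * B) i j.2).rank = n)
    (Q : Matrix (Fin n) (Fin n) ℝ) (hQ : Q.PosSemidef)
    (R : Matrix (Fin m) (Fin m) ℝ) (hR : R.PosDef)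
    (S₁ ST : Matrix (Fin n) (Fin n) ℝ) (hS₁ : S₁.PosDef) (hST : ST.PosDef)
    (μ₁ μT : Measure (Fin n → ℝ))
    (hμ₁ : μ₁ = volume.withDensity fun x =>
      ENNReal.ofReal ((Real.sqrt ((2 * Real.pi) ^ n * S₁.det))⁻¹ *
        Real.exp (-(x ⬝ᵥ S₁⁻¹.mulVec x) / 2)))
    (hμT : μT = volume.withDensity fun x =>
      ENNReal.ofReal ((Real.sqrt ((2 * Real.pi) ^ n * ST.det))⁻¹ *
        Real.exp (-(x ⬝ᵥ ST⁻¹.mulVec x) / 2))) :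
    sInf {r : ℝ | ∃ π : Measure ((Fin n → ℝ) × (Fin n → ℝ)),
        IsProbabilityMeasure π ∧ π.map Prod.fst = μ₁ ∧ π.map Prod.snd = μT ∧
        r = ∫ p, lqCost A B Q R T p.1 p.2 ∂π} =
      sSup {r : ℝ | ∃ P : ℕ → Matrix (Fin n) (Fin n) ℝ,
        (∀ k, k ≤ T - 1 → (P k).IsSymm) ∧
        (∀ k, k < T - 1 →
          (R + Bᵀ * P (k + 1) * B).PosDef ∧
          (Matrix.fromBlocks (R + Bᵀ * P (k + 1) * B) (Bᵀ * P (k + 1) * A)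
            (Aᵀ * P (k + 1) * B) (Aᵀ * P (k + 1) * A - P k + Q)).PosSemidef) ∧
        r = (P 0 * S₁).trace - (P (T - 1) * ST).trace} := by
  set N := T - 1 with hN
  obtain ⟨M₁, M₂, M₃, hM₁, hM₃, hleast⟩ :=
    exists_quadratic_isLeast_runningCost hctrb hQ hR hTn
  have hcost : ∀ x y, lqCost A B Q R T x y =
      x ⬝ᵥ M₁ *ᵥ x + 2 * (x ⬝ᵥ M₂ *ᵥ y) + y ⬝ᵥ M₃ *ᵥ y := fun x y => (hleast x y).csInf_eq
  obtain ⟨L, D, hL, hD, hLS, hM₂⟩ := exists_transport_factorization M₂ S₁ ST hS₁ hST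
  have hDs : D.IsSymm := isSymm_of_isHermitian hD.isHermitian
  change μ₁ = centeredGaussian S₁ at hμ₁
  change μT = centeredGaussian ST at hμT
  subst hμ₁ hμT
  have hquad : ∀ x y, x ⬝ᵥ M₁ *ᵥ x + 2 * (x ⬝ᵥ M₂ *ᵥ y) + y ⬝ᵥ M₃ *ᵥ y =
      x ⬝ᵥ (M₁ - Lᵀ * D * L) *ᵥ x - y ⬝ᵥ (D - M₃) *ᵥ y +
        (y - L *ᵥ x) ⬝ᵥ D *ᵥ (y - L *ᵥ x) := by
    intro x y
    have h1 : x ⬝ᵥ (Lᵀ * D) *ᵥ y = (L *ᵥ x) ⬝ᵥ D *ᵥ y := by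
      rw [← mulVec_mulVec, dotProduct_mulVec, vecMul_transpose]
    have h2 : x ⬝ᵥ (Lᵀ * D * L) *ᵥ x = (L *ᵥ x) ⬝ᵥ D *ᵥ (L *ᵥ x) := by
      rw [← mulVec_mulVec, ← mulVec_mulVec, dotProduct_mulVec, vecMul_transpose]
    rw [hM₂, neg_mulVec, dotProduct_neg, h1]
    simp only [sub_mulVec, mulVec_sub, dotProduct_sub, sub_dotProduct, h2]
    rw [dotProduct_mulVec_comm_of_isSymm hDs y (L *ᵥ x)]
    ring
  set V : ℝ := ((M₁ - Lᵀ * D * L) * S₁).trace - ((D - M₃) * ST).trace with hV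
  have hprob := isProbabilityMeasure_centeredGaussian hS₁
  have hmem : V ∈ {r : ℝ | ∃ π : Measure ((Fin n → ℝ) × (Fin n → ℝ)),
      IsProbabilityMeasure π ∧ π.map Prod.fst = centeredGaussian S₁ ∧
        π.map Prod.snd = centeredGaussian ST ∧ r = ∫ p, lqCost A B Q R T p.1 p.2 ∂π} := by
    have hgraph : Measurable fun x : Fin n → ℝ => (x, L *ᵥ x) :=
      measurable_id.prodMk (measurable_mulVec L)
    refine ⟨(centeredGaussian S₁).map fun x => (x, L *ᵥ x),
      Measure.isProbabilityMeasure_map hgraph.aemeasurable, ?_, ?_, ?_⟩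
    · rw [Measure.map_map measurable_fst hgraph]
      exact Measure.map_id
    · rw [Measure.map_map measurable_snd hgraph, ← hLS, ← map_mulVec_centeredGaussian hL]
      rfl
    · simp only [hcost]
      rw [integral_map hgraph.aemeasurable (by fun_prop)]
      have h1 : ∀ x : Fin n → ℝ, (L *ᵥ x) ⬝ᵥ (D - M₃) *ᵥ (L *ᵥ x) =
          x ⬝ᵥ (Lᵀ * (D - M₃) * L) *ᵥ x := fun x => by
        rw [← mulVec_mulVec, ← mulVec_mulVec, dotProduct_mulVec x, vecMul_transpose]
      simp only [hquad, sub_self, zero_dotProduct, add_zero, h1, ← dotProduct_sub, ← sub_mulVec]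
      rw [integral_dotProduct_mulVec_centeredGaussian hS₁, sub_mul (M₁ - _), trace_sub, hV, ← hLS]
      congr 1
      rw [Matrix.mul_assoc Lᵀ, Matrix.mul_assoc Lᵀ, trace_mul_comm Lᵀ]
      simp only [Matrix.mul_assoc]
  have hweak : ∀ a ∈ {r : ℝ | ∃ π : Measure ((Fin n → ℝ) × (Fin n → ℝ)),
      IsProbabilityMeasure π ∧ π.map Prod.fst = centeredGaussian S₁ ∧
        π.map Prod.snd = centeredGaussian ST ∧ r = ∫ p, lqCost A B Q R T p.1 p.2 ∂π},
      ∀ b ∈ {r : ℝ | ∃ P : ℕ → Matrix (Fin n) (Fin n) ℝ,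
        (∀ k, k ≤ N → (P k).IsSymm) ∧
        (∀ k, k < N →
          (R + Bᵀ * P (k + 1) * B).PosDef ∧
          (Matrix.fromBlocks (R + Bᵀ * P (k + 1) * B) (Bᵀ * P (k + 1) * A)
            (Aᵀ * P (k + 1) * B) (Aᵀ * P (k + 1) * A - P k + Q)).PosSemidef) ∧
        r = (P 0 * S₁).trace - (P N * ST).trace}, b ≤ a := by
    rintro _ ⟨π, hπ, hfst, hsnd, rfl⟩ _ ⟨P, -, hP, rfl⟩
    have hf : ∀ i, MemLp (fun p : (Fin n → ℝ) × (Fin n → ℝ) => p.1 i) 2 π := fun i =>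
      (memLp_coord_centeredGaussian hS₁ i).comp_measurePreserving ⟨measurable_fst, hfst⟩
    have hg : ∀ i, MemLp (fun p : (Fin n → ℝ) × (Fin n → ℝ) => p.2 i) 2 π := fun i =>
      (memLp_coord_centeredGaussian hST i).comp_measurePreserving ⟨measurable_snd, hsnd⟩
    have h1 : (P 0 * S₁).trace = ∫ p, p.1 ⬝ᵥ P 0 *ᵥ p.1 ∂π := by
      rw [← integral_dotProduct_mulVec_centeredGaussian hS₁, ← hfst,
        integral_map measurable_fst.aemeasurable (by fun_prop)]
    have h2 : (P N * ST).trace = ∫ p, p.2 ⬝ᵥ P N *ᵥ p.2 ∂π := by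
      rw [← integral_dotProduct_mulVec_centeredGaussian hST, ← hsnd,
        integral_map measurable_snd.aemeasurable (by fun_prop)]
    rw [h1, h2, ← integral_sub (integrable_dotProduct_mulVec_of_memLp hf hf _)
      (integrable_dotProduct_mulVec_of_memLp hg hg _)]
    simp only [hcost]
    refine integral_mono ((integrable_dotProduct_mulVec_of_memLp hf hf _).sub
      (integrable_dotProduct_mulVec_of_memLp hg hg _))
      (((integrable_dotProduct_mulVec_of_memLp hf hf _).add
        ((integrable_dotProduct_mulVec_of_memLp hf hg _).const_mul 2)).add
        (integrable_dotProduct_mulVec_of_memLp hg hg _)) fun p => ?_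
    obtain ⟨u, hu, hval⟩ := (hleast p.1 p.2).1
    have := quadratic_le_runningCost_add (fun k hk => (hP k hk).2) p.1 u
    rw [hu] at this
    change _ - _ ≤ _ + _ + _
    linarith
  have hdual : ∀ ε > 0, ∃ b ∈ {r : ℝ | ∃ P : ℕ → Matrix (Fin n) (Fin n) ℝ,
        (∀ k, k ≤ N → (P k).IsSymm) ∧
        (∀ k, k < N →
          (R + Bᵀ * P (k + 1) * B).PosDef ∧
          (Matrix.fromBlocks (R + Bᵀ * P (k + 1) * B) (Bᵀ * P (k + 1) * A)
            (Aᵀ * P (k + 1) * B) (Aᵀ * P (k + 1) * A - P k + Q)).PosSemidef) ∧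
        r = (P 0 * S₁).trace - (P N * ST).trace}, V - ε * ST.trace ≤ b := by
    intro ε hε
    have hlow : ∀ x u, x ⬝ᵥ (M₁ - Lᵀ * D * L) *ᵥ x +
        ε * (ltraj A B x u N ⬝ᵥ ltraj A B x u N) ≤ runningCost A B Q R N x u +
          ltraj A B x u N ⬝ᵥ (D - M₃ + ε • (1 : Matrix (Fin n) (Fin n) ℝ)) *ᵥ ltraj A B x u N := by
      intro x u
      have h1 := (hleast x (ltraj A B x u N)).2 ⟨u, rfl, rfl⟩
      rw [hquad] at h1
      have h2 := dotProduct_mulVec_nonneg_of_posSemidef hD (ltraj A B x u N - L *ᵥ x)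
      rw [add_mulVec, dotProduct_add, smul_mulVec, one_mulVec, dotProduct_smul, smul_eq_mul]
      linarith
    obtain ⟨P, hPN, hPs, hPf, hPatt⟩ := exists_riccati_sequence (A := A) (B := B)
      (isSymm_of_isHermitian hQ.isHermitian) (isSymm_of_isHermitian hR.isHermitian) N
      (G := D - M₃ + ε • 1) ((hDs.sub hM₃).add (isSymm_one.smul ε)) (by
        rintro u ⟨k, hk, hu⟩
        rcases eq_or_ne (ltraj A B 0 u N) 0 with h0 | h0
        · rw [h0, zero_dotProduct, add_zero]
          exact runningCost_pos hQ hR hk hu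
        · have h1 := hlow 0 u
          have h2 : 0 < ltraj A B 0 u N ⬝ᵥ ltraj A B 0 u N := by
            simpa using dotProduct_star_self_pos_iff.mpr h0
          rw [zero_dotProduct, zero_add] at h1
          exact (mul_pos hε h2).trans_le h1)
    refine ⟨_, ⟨P, hPs, hPf, rfl⟩, ?_⟩
    have hF : ((M₁ - Lᵀ * D * L) * S₁).trace ≤ (P 0 * S₁).trace := by
      rw [← integral_dotProduct_mulVec_centeredGaussian hS₁,
        ← integral_dotProduct_mulVec_centeredGaussian hS₁]
      refine integral_mono
        (integrable_dotProduct_mulVec_of_memLp (memLp_coord_centeredGaussian hS₁)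
          (memLp_coord_centeredGaussian hS₁) _)
        (integrable_dotProduct_mulVec_of_memLp (memLp_coord_centeredGaussian hS₁)
          (memLp_coord_centeredGaussian hS₁) _) fun x => ?_
      obtain ⟨u, hu⟩ := hPatt x
      have h1 := hlow x u
      have h2 : 0 ≤ ltraj A B x u N ⬝ᵥ ltraj A B x u N := by
        simpa using dotProduct_star_self_nonneg (ltraj A B x u N)
      have h3 := mul_nonneg hε.le h2
      change _ ≤ _
      rw [← hu]
      linarith
    rw [hPN, add_mul, trace_add, smul_mul, Matrix.one_mul, trace_smul, smul_eq_mul, hV]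
    linarith
  obtain ⟨b₀, hb₀, -⟩ := hdual 1 one_pos
  refine le_antisymm ?_ (csSup_le ⟨b₀, hb₀⟩ fun b hb => le_csInf ⟨V, hmem⟩ fun a ha =>
    hweak a ha b hb)
  refine (csInf_le ⟨b₀, fun a ha => hweak a ha b₀ hb₀⟩ hmem).trans ?_
  refine le_of_forall_pos_le_add fun δ hδ => ?_
  have htr : 0 ≤ ST.trace := hST.posSemidef.trace_nonneg
  obtain ⟨b, hb, hle⟩ := hdual (δ / (ST.trace + 1)) (by positivity)
  have h1 := le_csSup ⟨V, fun b hb => hweak V hmem b hb⟩ hb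
  have h2 : δ / (ST.trace + 1) * ST.trace ≤ δ := by
    rw [div_mul_eq_mul_div, div_le_iff₀ (by positivity)]
    nlinarith
  linarith
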